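/- For β ≥ 0, the infimum λ₁(β,−1) = inf { ∫_{−1}^1 (|φ'|² − (β/(y+1))|φ|²) dy : φ ∈ H₀¹(−1,1), ‖φ‖_{L²(−1,1)} = 1 } is attained by some φ_β ∈ H₀¹(−1,1) with ‖φ_β‖_{L²} = 1. -/

import Mathlib

open MeasureTheory Real Set Filter

/-- The set of values of the Rayleigh–Kuo quadratic form
`∫_{-1}^1 (|φ'|² - (β/(y-c))|φ|²) dy` over `L²`-normalized `φ ∈ H₀¹(-1,1)`. -/
noncomputable def rayleighSet (β c : ℝ) : Set ℝ :=
  { r | ∃ φ dφ : ℝ → ℝ,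
      (∀ y, HasDerivAt φ (dφ y) y) ∧ φ (-1) = 0 ∧ φ 1 = 0 ∧
      IntervalIntegrable (fun y => dφ y ^ 2) volume (-1) 1 ∧
      IntervalIntegrable (fun y => β / (y - c) * φ y ^ 2) volume (-1) 1 ∧
      (∫ y in (-1:ℝ)..1, φ y ^ 2) = 1 ∧
      r = ∫ y in (-1:ℝ)..1, (dφ y ^ 2 - β / (y - c) * φ y ^ 2) }

/-- The principal eigenvalue `λ₁(β,c)` of the Rayleigh–Kuo boundary value problem,
defined variationally as the infimum of the quadratic form. -/
noncomputable def lambda1 (β c : ℝ) : ℝ := sInf (rayleighSet β c)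

/-- The exponential generating function `∑ eₙ xⁿ / n!` of a real sequence. -/
noncomputable def egf (e : ℕ → ℝ) (x : ℝ) : ℝ := ∑' n, e n * (x ^ n / n.factorial)

theorem hasSum_egf {e : ℕ → ℝ} {C M : ℝ} (he : ∀ n, |e n| ≤ C * M ^ n) (x : ℝ) :
    HasSum (fun n => e n * (x ^ n / n.factorial)) (egf e x) := by
  have hs := (Real.summable_pow_div_factorial (M * |x|)).mul_left C
  refine Summable.hasSum (Summable.of_norm_bounded hs fun n => ?_)
  rw [Real.norm_eq_abs, abs_mul, abs_div, abs_pow, Nat.abs_cast, mul_pow]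
  calc |e n| * (|x| ^ n / n.factorial) ≤ C * M ^ n * (|x| ^ n / n.factorial) := by
        gcongr; exact he n
    _ = _ := by ring

theorem egf_zero (e : ℕ → ℝ) : egf e 0 = e 0 := by
  unfold egf
  rw [tsum_eq_single 0 (by intro n hn; simp [hn])]
  simp

theorem succ_div_factorial_succ (n : ℕ) :
    ((n + 1 : ℕ) : ℝ) / (n + 1).factorial = 1 / n.factorial := by
  have : (n.factorial : ℝ) ≠ 0 := by positivity
  rw [Nat.factorial_succ]
  push_cast
  field_simp

theorem hasSum_mul_egf {e : ℕ → ℝ} {C M : ℝ} (he : ∀ n, |e n| ≤ C * M ^ n) (x : ℝ) :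
    HasSum (fun n : ℕ => n * e (n - 1) * (x ^ n / n.factorial)) (x * egf e x) := by
  rw [← hasSum_nat_add_iff' 1]
  simp only [Finset.range_one, Finset.sum_singleton, Nat.cast_zero, zero_mul, sub_zero]
  refine ((hasSum_egf he x).mul_left x).congr_fun fun n => ?_
  rw [Nat.add_sub_cancel]
  calc _ = e n * x ^ (n + 1) * (((n + 1 : ℕ) : ℝ) / (n + 1).factorial) := by ring
    _ = _ := by rw [succ_div_factorial_succ]; ring

theorem bound_shift {e : ℕ → ℝ} {C M : ℝ} (he : ∀ n, |e n| ≤ C * M ^ n) (n : ℕ) :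
    |e (n + 1)| ≤ (C * M) * M ^ n := (he (n + 1)).trans_eq (by ring)

theorem hasDerivAt_egf {e : ℕ → ℝ} {C M : ℝ} (hM : 0 ≤ M) (he : ∀ n, |e n| ≤ C * M ^ n)
    (x : ℝ) : HasDerivAt (egf e) (egf (fun n => e (n + 1)) x) x := by
  set R : ℝ := |x| + 1 with hR
  have hR0 : 0 < R := by positivity
  have hC : 0 ≤ C := by simpa using (abs_nonneg _).trans (he 0)
  have hu : Summable fun n : ℕ => C * M ^ n * (n * R ^ (n - 1) / n.factorial) := by
    rw [← summable_nat_add_iff 1]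
    refine ((Real.summable_pow_div_factorial (M * R)).mul_left (C * M)).congr fun n => ?_
    rw [Nat.add_sub_cancel, mul_div_right_comm, succ_div_factorial_succ]
    rw [mul_pow]
    ring
  have h := hasDerivAt_tsum_of_isPreconnected (𝕜 := ℝ)
    (g := fun n y => e n * (y ^ n / n.factorial))
    (g' := fun n y => e n * (n * y ^ (n - 1) / n.factorial))
    (t := Metric.ball 0 R) (y₀ := x) (y := x) hu Metric.isOpen_ball
    (convex_ball _ _).isPreconnected
    (fun n y _ => ((hasDerivAt_pow n y).div_const _).const_mul _)
    (fun n y hy => by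
      have hy' : |y| ≤ R := by simpa using (mem_ball_zero_iff.1 hy).le
      rw [Real.norm_eq_abs, abs_mul, abs_div, abs_mul, abs_pow, Nat.abs_cast, Nat.abs_cast]
      gcongr
      exact he n)
    (by rw [mem_ball_zero_iff, Real.norm_eq_abs]; linarith) (hasSum_egf he x).summable
    (by rw [mem_ball_zero_iff, Real.norm_eq_abs]; linarith)
  refine h.congr_deriv (HasSum.tsum_eq ?_)
  rw [← hasSum_nat_add_iff' 1]
  simp only [Finset.range_one, Finset.sum_singleton, Nat.cast_zero, zero_mul, zero_div, mul_zero,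
    sub_zero]
  refine (hasSum_egf (bound_shift he) x).congr_fun fun n => ?_
  rw [Nat.add_sub_cancel, mul_div_right_comm, succ_div_factorial_succ]
  ring

/-- The Taylor coefficients (multiplied by `n!`) at `0` of the regular solution of
`x ψ'' + 2 ψ' + (β + E x) ψ = 0` with `ψ 0 = 1`. -/
noncomputable def coulombCoeff (β E : ℝ) : ℕ → ℝ
  | 0 => 1
  | 1 => -β / 2
  | n + 2 => -(β * coulombCoeff β E (n + 1) + E * (n + 1) * coulombCoeff β E n) / (n + 3)

theorem coulombCoeff_rec (β E : ℝ) (n : ℕ) :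
    (n + 2) * coulombCoeff β E (n + 1) + β * coulombCoeff β E n
      + E * (n * coulombCoeff β E (n - 1)) = 0 := by
  cases n with
  | zero => simp [coulombCoeff]; linarith
  | succ n =>
    rw [coulombCoeff, Nat.add_sub_cancel]
    have : (n : ℝ) + 3 ≠ 0 := by positivity
    push_cast
    field_simp
    ring

theorem abs_coulombCoeff_le {β E L : ℝ} (hL : |E| ≤ L) :
    ∀ n, |coulombCoeff β E n| ≤ 1 * (1 + |β| + L) ^ n := by
  have hL0 : 0 ≤ L := (abs_nonneg E).trans hL
  intro n
  rw [one_mul]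
  induction n using Nat.twoStepInduction with
  | zero => simp [coulombCoeff]
  | one =>
    rw [coulombCoeff, abs_div, abs_neg, pow_one, abs_two]
    linarith [abs_nonneg β]
  | more n h0 h1 =>
    rw [coulombCoeff, abs_div, abs_neg, abs_of_pos (by positivity : (0 : ℝ) < n + 3),
      div_le_iff₀ (by positivity)]
    set M : ℝ := 1 + |β| + L with hM
    have hM1 : 1 ≤ M := by linarith [abs_nonneg β]
    have hpow : M ^ n ≤ M ^ (n + 1) := pow_le_pow_right₀ hM1 n.le_succ
    calc |β * coulombCoeff β E (n + 1) + E * (n + 1) * coulombCoeff β E n|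
        ≤ |β| * |coulombCoeff β E (n + 1)| + |E| * (n + 1) * |coulombCoeff β E n| := by
          refine (abs_add_le _ _).trans_eq ?_
          rw [abs_mul, abs_mul, abs_mul, abs_of_nonneg (by positivity : (0 : ℝ) ≤ n + 1)]
      _ ≤ |β| * M ^ (n + 1) + L * (n + 1) * M ^ (n + 1) := by
          gcongr
          exact h0.trans hpow
      _ ≤ |β| * M ^ (n + 1) * (n + 3) + L * M ^ (n + 1) * (n + 3) + 1 * M ^ (n + 1) * (n + 3) := by
          have h1 : 0 ≤ |β| * M ^ (n + 1) * n := by positivity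
          have h2 : 0 ≤ |β| * M ^ (n + 1) := by positivity
          have h3 : 0 ≤ L * M ^ (n + 1) := by positivity
          have h4 : 0 ≤ M ^ (n + 1) * (n + 3) := by positivity
          linarith
      _ = M ^ (n + 2) * (n + 3) := by rw [hM]; ring

theorem continuous_coulombCoeff (β : ℝ) (n : ℕ) : Continuous fun E => coulombCoeff β E n := by
  induction n using Nat.twoStepInduction with
  | zero => simpa [coulombCoeff] using continuous_const
  | one => simpa [coulombCoeff] using continuous_const
  | more n h0 h1 => simp only [coulombCoeff]; fun_prop

theorem coulombCoeff_ground (β : ℝ) (n : ℕ) :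
    coulombCoeff β (-(β ^ 2 / 4)) n = (-β / 2) ^ n := by
  induction n using Nat.twoStepInduction with
  | zero => simp [coulombCoeff]
  | one => simp [coulombCoeff]
  | more n h0 h1 =>
    rw [coulombCoeff, h0, h1]
    have : (n : ℝ) + 3 ≠ 0 := by positivity
    field_simp
    ring

/-- The regular solution `ψ` of `x ψ'' + 2 ψ' + (β + E x) ψ = 0` with `ψ 0 = 1`. -/
noncomputable def coulomb (β E : ℝ) : ℝ → ℝ := egf (coulombCoeff β E)

/-- The derivative of `coulomb`. -/
noncomputable def coulombDeriv (β E : ℝ) : ℝ → ℝ := egf fun n => coulombCoeff β E (n + 1)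

theorem coulomb_zero (β E : ℝ) : coulomb β E 0 = 1 := egf_zero _

theorem hasDerivAt_coulomb (β E x : ℝ) :
    HasDerivAt (coulomb β E) (coulombDeriv β E x) x :=
  hasDerivAt_egf (by positivity) (abs_coulombCoeff_le le_rfl) x

theorem hasDerivAt_mul_coulomb (β E x : ℝ) :
    HasDerivAt (fun x => x * coulomb β E x) (coulomb β E x + x * coulombDeriv β E x) x := by
  refine ((hasDerivAt_id x).mul (hasDerivAt_coulomb β E x)).congr_deriv ?_
  simp

theorem hasDerivAt_deriv_mul_coulomb (β E x : ℝ) :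
    HasDerivAt (fun x => coulomb β E x + x * coulombDeriv β E x)
      (-((β + E * x) * coulomb β E x)) x := by
  have hb := abs_coulombCoeff_le (β := β) (le_refl |E|)
  have hb' := bound_shift hb
  have h2 := hasDerivAt_egf (by positivity) hb' x
  have hd := (hasDerivAt_coulomb β E x).add ((hasDerivAt_id x).mul h2)
  have hode := (((hasSum_mul_egf (bound_shift hb') x).add ((hasSum_egf hb' x).mul_left 2)).add
    ((hasSum_egf hb x).mul_left β)).add ((hasSum_mul_egf hb x).mul_left E)
  have h0 := hode.unique (hasSum_zero.congr_fun ?_)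
  · refine hd.congr_deriv ?_
    simp only [id, coulombDeriv, coulomb]
    linarith
  · intro n
    cases n with
    | zero => have := coulombCoeff_rec β E 0; simp at this ⊢; linarith
    | succ n =>
      have := congrArg (· * (x ^ (n + 1) / (n + 1).factorial)) (coulombCoeff_rec β E (n + 1))
      simp only [Nat.add_sub_cancel, zero_mul] at this ⊢
      rw [← this]
      push_cast
      ring

theorem continuous_coulomb_uncurry (β : ℝ) :
    Continuous fun p : ℝ × ℝ => coulomb β p.1 p.2 := by
  rw [continuous_iff_continuousAt]
  rintro ⟨E, x⟩
  have hU : Metric.ball (0 : ℝ) (|E| + 1) ×ˢ Metric.ball (0 : ℝ) (|x| + 1) ∈ nhds (E, x) :=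
    (Metric.isOpen_ball.prod Metric.isOpen_ball).mem_nhds
      ⟨by simp, by simp⟩
  have hc : ∀ n : ℕ, Continuous fun p : ℝ × ℝ =>
      coulombCoeff β p.1 n * (p.2 ^ n / (n.factorial : ℝ)) := fun n =>
    ((continuous_coulombCoeff β n).comp continuous_fst).mul
      ((continuous_snd.pow n).div_const _)
  have hb : ∀ (n : ℕ) (p : ℝ × ℝ),
      p ∈ Metric.ball (0 : ℝ) (|E| + 1) ×ˢ Metric.ball (0 : ℝ) (|x| + 1) →
      ‖coulombCoeff β p.1 n * (p.2 ^ n / (n.factorial : ℝ))‖ ≤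
        ((1 + |β| + (|E| + 1)) * (|x| + 1)) ^ n / n.factorial := by
    rintro n ⟨F, y⟩ ⟨hF, hy⟩
    have hF' : |F| ≤ |E| + 1 := by simpa using (mem_ball_zero_iff.1 hF).le
    have hy' : |y| ≤ |x| + 1 := by simpa using (mem_ball_zero_iff.1 hy).le
    rw [Real.norm_eq_abs, abs_mul, abs_div, abs_pow, Nat.abs_cast, mul_pow, mul_div_assoc]
    have := abs_coulombCoeff_le (β := β) hF' n
    rw [one_mul] at this
    gcongr
  exact (continuousOn_tsum (fun n => (hc n).continuousOn)
    (Real.summable_pow_div_factorial _) hb).continuousAt hU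

theorem coulomb_ground_pos (β x : ℝ) : 0 < coulomb β (-(β ^ 2 / 4)) x := by
  have : coulomb β (-(β ^ 2 / 4)) x = Real.exp (-β / 2 * x) := by
    rw [Real.exp_eq_exp_ℝ, NormedSpace.exp_eq_tsum_div]
    simp only [coulomb, egf, coulombCoeff_ground, mul_pow, mul_div_assoc]
  rw [this]
  positivity

theorem deriv_mul_coulomb_ne_zero {β E x₀ : ℝ} (hβ : 0 ≤ β) (hx₀ : 0 < x₀)
    (hnn : ∀ x ∈ Icc 0 x₀, 0 ≤ coulomb β E x) (h₀ : coulomb β E x₀ = 0) :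
    coulomb β E x₀ + x₀ * coulombDeriv β E x₀ ≠ 0 := by
  intro hd
  set m : ℝ := 1 + |E| with hm
  have hm1 : 1 ≤ m := by linarith [abs_nonneg E]
  have hH : ∀ x, HasDerivAt
      (fun x => rexp (m * x) * ((coulomb β E x + x * coulombDeriv β E x) - m * (x * coulomb β E x)))
      (rexp (m * x) * (-((β + E * x + m ^ 2 * x) * coulomb β E x))) x := fun x => by
    refine (((hasDerivAt_id x).const_mul m).exp.mul ((hasDerivAt_deriv_mul_coulomb β E x).sub
      ((hasDerivAt_mul_coulomb β E x).const_mul m))).congr_deriv ?_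
    simp only [id, mul_one, Pi.sub_apply]
    ring
  have hanti : AntitoneOn
      (fun x => rexp (m * x) * ((coulomb β E x + x * coulombDeriv β E x) - m * (x * coulomb β E x)))
      (Icc 0 x₀) := by
    refine antitoneOn_of_hasDerivWithinAt_nonpos (convex_Icc _ _)
      (fun x _ => (hH x).continuousAt.continuousWithinAt)
      (fun x _ => (hH x).hasDerivWithinAt) fun x hx => ?_
    have hx' : x ∈ Icc 0 x₀ := interior_subset hx
    have hE : 0 ≤ E + m ^ 2 := by nlinarith [neg_abs_le E]
    have : 0 ≤ β + E * x + m ^ 2 * x := by nlinarith [mul_nonneg hE hx'.1]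
    have := mul_nonneg this (hnn x hx')
    nlinarith [Real.exp_pos (m * x)]
  have hmono : MonotoneOn (fun x => x * coulomb β E x) (Icc 0 x₀) := by
    refine monotoneOn_of_hasDerivWithinAt_nonneg (convex_Icc _ _)
      (fun x _ => (hasDerivAt_mul_coulomb β E x).continuousAt.continuousWithinAt)
      (fun x _ => (hasDerivAt_mul_coulomb β E x).hasDerivWithinAt) fun x hx => ?_
    have hx' : x ∈ Icc 0 x₀ := interior_subset hx
    have h := hanti hx' (right_mem_Icc.2 hx₀.le) hx'.2
    beta_reduce at h
    rw [hd, h₀, mul_zero, mul_zero, sub_zero, mul_zero] at h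
    have h' := nonneg_of_mul_nonneg_right h (Real.exp_pos _)
    have := mul_nonneg (zero_le_one.trans hm1) (mul_nonneg hx'.1 (hnn x hx'))
    linarith
  have hpos : ∀ᶠ x in nhds 0, 0 < coulomb β E x :=
    (hasDerivAt_coulomb β E 0).continuousAt.eventually
      (lt_mem_nhds (by rw [coulomb_zero]; exact one_pos))
  obtain ⟨x, hx, hxI⟩ := ((hpos.filter_mono nhdsWithin_le_nhds).and (Ioo_mem_nhdsGT hx₀)).exists
  have h := hmono ⟨hxI.1.le, hxI.2.le⟩ (right_mem_Icc.2 hx₀.le) hxI.2.le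
  simp only [h₀, mul_zero] at h
  exact absurd h (not_le.2 (mul_pos hxI.1 hx))

theorem coulomb_two_nonpos {β : ℝ} (hβ : 0 ≤ β)
    (hnn : ∀ x ∈ Icc (0 : ℝ) 2, 0 ≤ coulomb β (π ^ 2 / 4) x) : coulomb β (π ^ 2 / 4) 2 ≤ 0 := by
  set E : ℝ := π ^ 2 / 4 with hE
  have hsin : ∀ x : ℝ, HasDerivAt (fun x => sin (π / 2 * x)) (π / 2 * cos (π / 2 * x)) x :=
    fun x => by
      refine ((hasDerivAt_id x).const_mul (π / 2)).sin.congr_deriv ?_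
      simp [mul_comm]
  have hcos : ∀ x : ℝ, HasDerivAt (fun x => π / 2 * cos (π / 2 * x)) (-(E * sin (π / 2 * x))) x :=
    fun x => by
      refine (((hasDerivAt_id x).const_mul (π / 2)).cos.const_mul (π / 2)).congr_deriv ?_
      simp only [id, mul_one, hE]
      ring
  have hW : ∀ x, HasDerivAt (fun x => (coulomb β E x + x * coulombDeriv β E x) * sin (π / 2 * x)
      - x * coulomb β E x * (π / 2 * cos (π / 2 * x))) (-(β * (coulomb β E x * sin (π / 2 * x)))) x :=
    fun x => by
      refine (((hasDerivAt_deriv_mul_coulomb β E x).mul (hsin x)).sub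
        ((hasDerivAt_mul_coulomb β E x).mul (hcos x))).congr_deriv ?_
      ring
  have hanti : AntitoneOn (fun x => (coulomb β E x + x * coulombDeriv β E x) * sin (π / 2 * x)
      - x * coulomb β E x * (π / 2 * cos (π / 2 * x))) (Icc 0 2) := by
    refine antitoneOn_of_hasDerivWithinAt_nonpos (convex_Icc _ _)
      (fun x _ => (hW x).continuousAt.continuousWithinAt)
      (fun x _ => (hW x).hasDerivWithinAt) fun x hx => ?_
    have hx' : x ∈ Icc (0 : ℝ) 2 := interior_subset hx
    have hs : 0 ≤ sin (π / 2 * x) := sin_nonneg_of_nonneg_of_le_pi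
      (mul_nonneg (by positivity) hx'.1) (by nlinarith [hx'.2, pi_pos])
    exact neg_nonpos.2 (mul_nonneg hβ (mul_nonneg (hnn x hx') hs))
  have h := hanti (left_mem_Icc.2 zero_le_two) (right_mem_Icc.2 zero_le_two) zero_le_two
  have h2 : π / 2 * 2 = π := by ring
  simp only [h2, sin_pi, cos_pi, mul_zero, zero_mul, sin_zero, sub_zero, zero_sub] at h
  nlinarith [pi_pos]

/-- For `β ≥ 0` some energy makes the regular solution positive on `[0, 2)` with a simple zero
at `2`. -/
theorem exists_energy {β : ℝ} (hβ : 0 ≤ β) :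
    ∃ E, (∀ x ∈ Ico (0 : ℝ) 2, 0 < coulomb β E x) ∧ coulomb β E 2 = 0 ∧
      coulomb β E 2 + 2 * coulombDeriv β E 2 ≠ 0 := by
  set m : ℝ → ℝ := fun E => sInf (coulomb β E '' Icc 0 2) with hm
  have hcont : ∀ E, Continuous (coulomb β E) := fun E =>
    continuous_iff_continuousAt.2 fun x => (hasDerivAt_coulomb β E x).continuousAt
  have hmem : ∀ E, m E ∈ coulomb β E '' Icc 0 2 := fun E =>
    (isCompact_Icc.image (hcont E)).sInf_mem ((nonempty_Icc.2 zero_le_two).image _)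
  have hle : ∀ E, ∀ x ∈ Icc (0 : ℝ) 2, m E ≤ coulomb β E x := fun E x hx =>
    csInf_le (isCompact_Icc.image (hcont E)).bddBelow (mem_image_of_mem _ hx)
  have hmc : Continuous m := isCompact_Icc.continuous_sInf (continuous_coulomb_uncurry β)
  have h1 : 0 ≤ m (-(β ^ 2 / 4)) := by
    obtain ⟨x, -, hx⟩ := hmem (-(β ^ 2 / 4))
    rw [← hx]
    exact (coulomb_ground_pos β x).le
  have h2 : m (π ^ 2 / 4) ≤ 0 := by
    by_contra! h
    exact absurd (coulomb_two_nonpos hβ fun x hx => h.le.trans (hle _ x hx))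
      (not_le.2 (h.trans_le (hle _ 2 (right_mem_Icc.2 zero_le_two))))
  have hEE : -(β ^ 2 / 4) ≤ π ^ 2 / 4 := by nlinarith [sq_nonneg β, sq_nonneg π]
  obtain ⟨E, -, hE⟩ := intermediate_value_Icc' hEE hmc.continuousOn ⟨h2, h1⟩
  have hnn : ∀ x ∈ Icc (0 : ℝ) 2, 0 ≤ coulomb β E x := fun x hx => hE ▸ hle E x hx
  have hpos : ∀ x ∈ Ico (0 : ℝ) 2, 0 < coulomb β E x := by
    intro x hx
    refine (hnn x (Ico_subset_Icc_self hx)).lt_of_ne' fun h0 => ?_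
    have hx0 : 0 < x := hx.1.lt_of_ne' fun h => by
      rw [h, coulomb_zero] at h0
      exact one_ne_zero h0
    have hmin : IsLocalMin (coulomb β E) x := by
      filter_upwards [Icc_mem_nhds hx0 hx.2] with y hy
      rw [h0]
      exact hnn y hy
    have hd := hmin.hasDerivAt_eq_zero (hasDerivAt_coulomb β E x)
    exact deriv_mul_coulomb_ne_zero hβ hx0 (fun y hy => hnn y ⟨hy.1, hy.2.trans hx.2.le⟩) h0
      (by rw [h0, hd]; ring)
  obtain ⟨x, hx, hx0⟩ := hmem E
  have hx2 : x = 2 := by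
    by_contra hne
    have := hpos x ⟨hx.1, hx.2.lt_of_ne hne⟩
    rw [hx0, hE] at this
    exact lt_irrefl _ this
  have h0 : coulomb β E 2 = 0 := by rw [← hx2, hx0, hE]
  exact ⟨E, hpos, h0, deriv_mul_coulomb_ne_zero hβ two_pos hnn h0⟩

theorem tendsto_div_of_hasDerivAt {f w : ℝ → ℝ} {f' w' c : ℝ} (hf : HasDerivAt f f' c)
    (hw : HasDerivAt w w' c) (hf0 : f c = 0) (hw0 : w c = 0) (hw' : w' ≠ 0) :
    Tendsto (fun x => f x / w x) (nhdsWithin c {c}ᶜ) (nhds (f' / w')) := by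
  refine ((hasDerivAt_iff_tendsto_slope.1 hf).div (hasDerivAt_iff_tendsto_slope.1 hw) hw').congr' ?_
  filter_upwards [self_mem_nhdsWithin] with x hx
  have : x - c ≠ 0 := sub_ne_zero.2 hx
  simp only [Pi.div_apply, slope_def_field, hf0, hw0, sub_zero]
  exact div_div_div_cancel_right₀ this _ _

theorem continuousAt_sq_mul_logDeriv {f w dw : ℝ → ℝ} {f' c : ℝ} (hf : HasDerivAt f f' c)
    (hw : HasDerivAt w (dw c) c) (hdw : ContinuousAt dw c) (hf0 : f c = 0) (hw0 : w c = 0)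
    (hw' : dw c ≠ 0) : ContinuousAt (fun x => f x ^ 2 * dw x / w x) c := by
  rw [continuousAt_iff_punctured_nhds]
  have h := ((hf.continuousAt.tendsto.mono_left nhdsWithin_le_nhds).mul
    (tendsto_div_of_hasDerivAt hf hw hf0 hw0 hw')).mul
    (hdw.tendsto.mono_left (nhdsWithin_le_nhds (s := {c}ᶜ)))
  simp only [hf0, zero_mul] at h
  simp only [hw0, div_zero]
  exact h.congr fun x => by ring

/-- Jacobi's inequality: if `w'' = -V w` has a positive solution on `(a, b)` with simple zeros at
the endpoints, the quadratic form `∫ (f'² - V f²)` is nonnegative on functions vanishing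
at the endpoints. -/
theorem integral_sq_deriv_sub_nonneg {a b : ℝ} (hab : a ≤ b) {V w dw f df : ℝ → ℝ}
    (hw : ∀ x, HasDerivAt w (dw x) x) (hdwc : Continuous dw)
    (hdw : ∀ x ∈ Ioo a b, HasDerivAt dw (-(V x * w x)) x)
    (hpos : ∀ x ∈ Ioo a b, 0 < w x) (hwa : w a = 0) (hwb : w b = 0)
    (hdwa : dw a ≠ 0) (hdwb : dw b ≠ 0)
    (hf : ∀ x, HasDerivAt f (df x) x) (hfa : f a = 0) (hfb : f b = 0)
    (hint : IntervalIntegrable (fun x => df x ^ 2 - V x * f x ^ 2) volume a b) :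
    0 ≤ ∫ x in a..b, (df x ^ 2 - V x * f x ^ 2) := by
  have hderiv : ∀ x ∈ Ioo a b, HasDerivAt (fun x => f x ^ 2 * dw x / w x)
      ((df x ^ 2 - V x * f x ^ 2) - (df x - f x * dw x / w x) ^ 2) x := fun x hx => by
    have hne := (hpos x hx).ne'
    refine ((((hf x).pow 2).mul (hdw x hx)).div (hw x) hne).congr_deriv ?_
    simp only [Pi.pow_apply, Pi.mul_apply]
    field_simp
    ring
  have hcont : ContinuousOn (fun x => f x ^ 2 * dw x / w x) (Icc a b) := by
    intro x hx
    refine ContinuousAt.continuousWithinAt ?_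
    rcases eq_or_lt_of_le hx.1 with rfl | hax
    · exact continuousAt_sq_mul_logDeriv (hf _) (hw _) hdwc.continuousAt hfa hwa hdwa
    rcases eq_or_lt_of_le hx.2 with rfl | hxb
    · exact continuousAt_sq_mul_logDeriv (hf _) (hw _) hdwc.continuousAt hfb hwb hdwb
    · exact (hderiv x ⟨hax, hxb⟩).continuousAt
  have h := intervalIntegral.sub_le_integral_of_hasDeriv_right_of_le hab hcont
    (fun x hx => (hderiv x hx).hasDerivWithinAt)
    ((intervalIntegrable_iff_integrableOn_Icc_of_le hab).1 hint)
    (fun x _ => sub_le_self _ (sq_nonneg _))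
  simpa [hfa, hfb] using h

theorem isLeast_rayleighSet {β : ℝ} (hβ : 0 ≤ β) : ∃ E, IsLeast (rayleighSet β (-1)) E := by
  obtain ⟨E, hpos, h2, hd2⟩ := exists_energy hβ
  set w : ℝ → ℝ := fun y => (y + 1) * coulomb β E (y + 1) with hw_def
  set dw : ℝ → ℝ := fun y => coulomb β E (y + 1) + (y + 1) * coulombDeriv β E (y + 1) with hdw_def
  have hw : ∀ y, HasDerivAt w (dw y) y := fun y =>
    (hasDerivAt_mul_coulomb β E (y + 1)).comp_add_const y 1
  have hdw : ∀ y, HasDerivAt dw (-((β + E * (y + 1)) * coulomb β E (y + 1))) y := fun y =>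
    (hasDerivAt_deriv_mul_coulomb β E (y + 1)).comp_add_const y 1
  have hwc : Continuous w := continuous_iff_continuousAt.2 fun y => (hw y).continuousAt
  have hdwc : Continuous dw := continuous_iff_continuousAt.2 fun y => (hdw y).continuousAt
  have hψc : Continuous fun y => coulomb β E (y + 1) := continuous_iff_continuousAt.2 fun y =>
    ((hasDerivAt_coulomb β E (y + 1)).comp_add_const y 1).continuousAt
  have hwa : w (-1) = 0 := by simp [hw_def]
  have hwb : w 1 = 0 := by
    simp only [hw_def]
    norm_num [h2]
  have hdwa : dw (-1) ≠ 0 := by simp [hdw_def, coulomb_zero]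
  have hdwb : dw 1 ≠ 0 := by
    simp only [hdw_def]
    norm_num1
    exact hd2
  have hwpos : ∀ y ∈ Ioo (-1 : ℝ) 1, 0 < w y := fun y hy =>
    mul_pos (by linarith [hy.1]) (hpos _ ⟨by linarith [hy.1], by linarith [hy.2]⟩)
  have hVw : ∀ y, β / (y - (-1)) * w y ^ 2 = β * w y * coulomb β E (y + 1) := fun y => by
    rcases eq_or_ne (y + 1) 0 with h | h
    · simp [hw_def, h]
    · rw [sub_neg_eq_add]
      simp only [hw_def]
      field_simp
  have hVc : Continuous fun y => β / (y - (-1)) * w y ^ 2 := by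
    simp only [hVw]
    fun_prop
  refine ⟨E, ?_, ?_⟩
  · set N : ℝ := ∫ y in (-1 : ℝ)..1, w y ^ 2 with hN
    have hN0 : 0 < N := intervalIntegral.intervalIntegral_pos_of_pos_on
      ((hwc.pow 2).intervalIntegrable _ _) (fun y hy => pow_pos (hwpos y hy) 2) (by norm_num)
    have hs : (√N)⁻¹ ^ 2 = N⁻¹ := by rw [inv_pow, sq_sqrt hN0.le]
    have henergy : ∫ y in (-1 : ℝ)..1, (dw y ^ 2 - β / (y - (-1)) * w y ^ 2) = E * N := by
      have hG := intervalIntegral.integral_eq_sub_of_hasDerivAt (a := -1) (b := 1)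
        (fun y _ => (hw y).mul (hdw y)) (Continuous.intervalIntegrable (by fun_prop) _ _)
      rw [Pi.mul_apply, Pi.mul_apply, hwa, hwb, zero_mul, zero_mul, sub_zero] at hG
      have hi1 : IntervalIntegrable (fun y => dw y ^ 2 - β / (y - (-1)) * w y ^ 2)
          volume (-1) 1 := ((hdwc.pow 2).sub hVc).intervalIntegrable _ _
      have hi2 : IntervalIntegrable (fun y => E * w y ^ 2) volume (-1) 1 :=
        Continuous.intervalIntegrable (by fun_prop) _ _
      rw [hN, ← intervalIntegral.integral_const_mul, ← sub_eq_zero,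
        ← intervalIntegral.integral_sub hi1 hi2, ← hG]
      refine intervalIntegral.integral_congr fun y _ => ?_
      simp only [hVw]
      simp only [hw_def]
      ring
    refine ⟨fun y => (√N)⁻¹ * w y, fun y => (√N)⁻¹ * dw y, fun y => (hw y).const_mul _,
      by simp only [hwa, mul_zero], by simp only [hwb, mul_zero],
      Continuous.intervalIntegrable (by fun_prop) _ _, ?_, ?_, ?_⟩
    · refine (hVc.const_mul N⁻¹).intervalIntegrable _ _ |>.congr fun y _ => ?_
      simp only [mul_pow, hs]
      ring
    · simp only [mul_pow, hs, intervalIntegral.integral_const_mul]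
      exact inv_mul_cancel₀ hN0.ne'
    · calc E = N⁻¹ * (E * N) := by field_simp
        _ = ∫ y in (-1 : ℝ)..1, N⁻¹ * (dw y ^ 2 - β / (y - (-1)) * w y ^ 2) := by
          rw [intervalIntegral.integral_const_mul, henergy]
        _ = _ := by
          refine intervalIntegral.integral_congr fun y _ => ?_
          simp only [mul_pow, hs]
          ring
  · rintro r ⟨f, df, hf, hfa, hfb, hi1, hi2, hnorm, rfl⟩
    have hfc : Continuous f := continuous_iff_continuousAt.2 fun y => (hf y).continuousAt
    have hi3 : IntervalIntegrable (fun y => E * f y ^ 2) volume (-1) 1 :=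
      Continuous.intervalIntegrable (by fun_prop) _ _
    have hrw : ∀ y, df y ^ 2 - (β / (y - (-1)) + E) * f y ^ 2 =
        (df y ^ 2 - β / (y - (-1)) * f y ^ 2) - E * f y ^ 2 := fun y => by ring
    have h := integral_sq_deriv_sub_nonneg (a := -1) (b := 1) (by norm_num)
      (V := fun y => β / (y - (-1)) + E) hw hdwc (fun y hy => by
        refine (hdw y).congr_deriv ?_
        have : y + 1 ≠ 0 := by linarith [hy.1]
        simp only [hw_def, sub_neg_eq_add]
        field_simp) hwpos hwa hwb hdwa hdwb hf hfa hfb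
      (by simpa only [hrw] using (hi1.sub hi2).sub hi3)
    simp only [hrw] at h
    rw [intervalIntegral.integral_sub (hi1.sub hi2) hi3, intervalIntegral.integral_const_mul,
      hnorm, mul_one] at h
    linarith

/-- For `β ≥ 0`, the infimum `λ₁(β,-1)` is attained by some `L²`-normalized
`φ_β ∈ H₀¹(-1,1)`. -/
theorem lambda1_attained (β : ℝ) (hβ : 0 ≤ β) :
    ∃ φ dφ : ℝ → ℝ,
      (∀ y, HasDerivAt φ (dφ y) y) ∧ φ (-1) = 0 ∧ φ 1 = 0 ∧
      IntervalIntegrable (fun y => dφ y ^ 2) volume (-1) 1 ∧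
      IntervalIntegrable (fun y => β / (y - (-1)) * φ y ^ 2) volume (-1) 1 ∧
      (∫ y in (-1:ℝ)..1, φ y ^ 2) = 1 ∧
      (∫ y in (-1:ℝ)..1, (dφ y ^ 2 - β / (y - (-1)) * φ y ^ 2)) = lambda1 β (-1) := by
  obtain ⟨E, hE⟩ := isLeast_rayleighSet hβ
  obtain ⟨φ, dφ, h1, h2, h3, h4, h5, h6, h7⟩ := hE.1
  exact ⟨φ, dφ, h1, h2, h3, h4, h5, h6, h7.symm.trans hE.csInf_eq.symm⟩
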